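/- Let R be a cyclically reduced word over {X, X^{-1}, Y, Y^{-1}} (i.e., every cyclic permutation of R is reduced) such that phi(R) = 1 and R contains at least two X-letters. Then there exist nonzero integers k and k' such that some cyclic permutation of R contains a contiguous subword of the form X Y^k X^{-1}, and some cyclic permutation of R contains a contiguous subword of the form X^{-1} Y^{k'} X. (This is the paper's observation that, under Assumption 2.5, the relator always contains elementary-type subwords of both kinds.) -/

import Mathlib

/-- A letter of the alphabet `{X, X⁻¹, Y, Y⁻¹}`. -/
inductive L where
  | X | Xi | Y | Yi
deriving DecidableEq

/-- A word is a finite sequence of letters. -/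
abbrev Word := List L

/-- Whether a letter is an `X`-letter, i.e. `X` or `X⁻¹`. -/
def L.isX : L → Bool
  | .X => true
  | .Xi => true
  | _ => false

/-- The sign of a letter: `+1` for `X`, `-1` for `X⁻¹`, `0` for `Y`-letters. -/
def L.sgn : L → ℤ
  | .X => 1
  | .Xi => -1
  | _ => 0

/-- The formal inverse of a letter. -/
def L.inv : L → L
  | .X => .Xi
  | .Xi => .X
  | .Y => .Yi
  | .Yi => .Y

/-- `phi W` = (number of `X`'s in `W`) - (number of `X⁻¹`'s in `W`). -/
def phi (w : Word) : ℤ := (w.map L.sgn).sum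

/-- The subsequence of `X`-letters `x₁, …, xₙ` of a word. -/
def xLetters (w : Word) : Word := w.filter (·.isX)

/-- The number `n` of `X`-letters of a word. -/
def numX (w : Word) : ℕ := (xLetters w).length

/-- The `i`-th `X`-letter `xᵢ` of a word (1-indexed; junk value `Y` out of range). -/
def xLtr (w : Word) (i : ℕ) : L := (xLetters w).getD (i - 1) L.Y

/-- `phi (W₁ⁱ)`: the sign-sum of the first `i` `X`-letters of `W`. -/
def phiPrefix (w : Word) (i : ℕ) : ℤ := (((xLetters w).take i).map L.sgn).sum

/-- `W` is a disk word: it has `n ≥ 2` `X`-letters, its first letter is `x₁`,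
its last letter is `xₙ`, `x₁` and `xₙ` have opposite signs, and `phi W = 0`. -/
def IsDiskWord (w : Word) : Prop :=
  2 ≤ numX w ∧
  w.head? = (xLetters w).head? ∧
  w.getLast? = (xLetters w).getLast? ∧
  phi w = 0 ∧
  (xLtr w 1).sgn = -(xLtr w (numX w)).sgn

/-- A disk word `W = W₁ⁿ` is primitive if `phi (W₁ᵏ) ≠ 0` for all `1 < k < n`. -/
def IsPrimitive (w : Word) : Prop :=
  IsDiskWord w ∧ ∀ k, 1 < k → k < numX w → phiPrefix w k ≠ 0

/-- A disk word is upward if `x₁ = X`. -/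
def Upward (w : Word) : Prop := xLtr w 1 = L.X

/-- A disk word is downward if `x₁ = X⁻¹`. -/
def Downward (w : Word) : Prop := xLtr w 1 = L.Xi

/-- `eps W i = 1` if `xᵢ` has the same sign as `x₁`, and `0` otherwise. -/
def eps (w : Word) (i : ℕ) : ℤ := if xLtr w i = xLtr w 1 then 1 else 0

/-- The height `h(xᵢ)`: `phi (W₁ⁱ) - eps xᵢ` in the upward case and
`phi (W₁ⁱ) + eps xᵢ` in the downward case. -/
def height (w : Word) (i : ℕ) : ℤ :=
  if xLtr w 1 = L.X then phiPrefix w i - eps w i else phiPrefix w i + eps w i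

/-- A word is reduced if it has no adjacent pair of mutually inverse letters. -/
def Reduced (w : Word) : Prop := w.Chain' (fun a b => b ≠ a.inv)

/-- The (0-indexed) positions in `w` of its `X`-letters. -/
def xPos (w : Word) : List ℕ :=
  (List.range w.length).filter (fun i => (w.getD i L.Y).isX)

/-- `subword w i j` = `Wᵢʲ`, the contiguous subword of `w` from the `i`-th
to the `j`-th `X`-letter (1-indexed, inclusive). -/
def subword (w : Word) (i j : ℕ) : Word :=
  (w.take ((xPos w).getD (j - 1) 0 + 1)).drop ((xPos w).getD (i - 1) 0)

/-- `Y^m`: `m` copies of `Y` if `m ≥ 0`, `-m` copies of `Y⁻¹` if `m < 0`. -/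
def Ypow (m : ℤ) : Word :=
  if 0 ≤ m then List.replicate m.toNat L.Y else List.replicate (-m).toNat L.Yi


theorem phi_eq_count_sub_count (w : Word) :
    phi w = (w.count L.X : ℤ) - (w.count L.Xi : ℤ) := by
  unfold phi
  induction w with
  | nil => simp
  | cons a w ih => cases a <;> simp [L.sgn, ih] <;> ring

theorem numX_eq_count_add_count (w : Word) : numX w = w.count L.X + w.count L.Xi := by
  unfold numX xLetters
  induction w with
  | nil => simp
  | cons a w ih =>
    have hX : L.X.isX = true := rfl
    have hXi : L.Xi.isX = true := rfl
    have hY : L.Y.isX = false := rfl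
    have hYi : L.Yi.isX = false := rfl
    cases a <;> simp [hX, hXi, hY, hYi, ih] <;> ring

theorem Reduced.of_isInfix {v w : Word} (h : Reduced w) (hv : v <:+: w) : Reduced v := by
  obtain ⟨s, t, rfl⟩ := hv
  exact List.IsChain.right_of_append (List.IsChain.left_of_append h)

/-- A reduced word without `X`-letters is a power of `Y`. -/
theorem Reduced.exists_eq_Ypow {w : Word} (h : Reduced w) (hw : ∀ c ∈ w, c.isX = false) :
    ∃ k : ℤ, w = Ypow k := by
  cases w with
  | nil => exact ⟨0, by simp [Ypow]⟩
  | cons c w =>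
    have hchain : (c :: w).IsChain (· = ·) := by
      refine List.IsChain.imp_of_mem_imp (fun a b ha hb hab => ?_) h
      have ha' := hw a ha
      have hb' := hw b hb
      cases a <;> cases b <;> simp_all [L.isX, L.inv]
    have hrep : w = List.replicate w.length c := List.isChain_cons_eq_iff_eq_replicate.1 hchain
    have hc := hw c (by simp)
    have hpos : (0 : ℤ) ≤ (w.length : ℤ) + 1 := by positivity
    cases c with
    | X => simp [L.isX] at hc
    | Xi => simp [L.isX] at hc
    | Y =>
      refine ⟨(w.length : ℤ) + 1, ?_⟩
      have ht : ((w.length : ℤ) + 1).toNat = w.length + 1 := by omega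
      rw [Ypow, if_pos hpos, ht, List.replicate_succ, ← hrep]
    | Yi =>
      refine ⟨-((w.length : ℤ) + 1), ?_⟩
      have ht : (- -((w.length : ℤ) + 1)).toNat = w.length + 1 := by omega
      rw [Ypow, if_neg (by omega), ht, List.replicate_succ, ← hrep]

/-- A reduced word that starts with an `X`-letter and later contains its inverse has a subword
consisting of that letter, a nontrivial power of `Y`, and the inverse letter. -/
theorem Reduced.exists_isInfix_Ypow {a : L} {u : Word} (ha : a.isX = true)
    (h : Reduced (a :: u)) (hu : a.inv ∈ u) :
    ∃ k : ℤ, k ≠ 0 ∧ (a :: (Ypow k ++ [a.inv])) <:+: (a :: u) := by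
  obtain ⟨s, t, rfl, hs⟩ := List.eq_append_cons_of_mem hu
  obtain ⟨q, p, hqp, hq⟩ := List.eq_append_cons_of_mem (a := a) (xs := (a :: s).reverse) (by simp)
  have has : a :: s = p.reverse ++ a :: q.reverse := by
    simpa using congrArg List.reverse hqp
  have hinf : (a :: (q.reverse ++ [a.inv])) <:+: (a :: (s ++ a.inv :: t)) :=
    ⟨p.reverse, t, by
      rw [← List.cons_append (as := s), has]
      simp⟩
  have hqY : ∀ c ∈ q.reverse, c.isX = false := by
    intro c hc
    have hca : c ≠ a := by
      rintro rfl
      exact hq (by simpa using hc)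
    have hcs : c ∈ a :: s := by
      rw [has]
      simp_all
    have hci : c ≠ a.inv := by
      rintro rfl
      exact hs ((List.mem_cons.1 hcs).resolve_left hca)
    cases a <;> cases c <;> simp_all [L.isX, L.inv]
  have hred := h.of_isInfix hinf
  obtain ⟨k, hk⟩ := Reduced.exists_eq_Ypow (hred.of_isInfix ⟨[a], [a.inv], by simp⟩) hqY
  rw [hk] at hinf hred
  refine ⟨k, ?_, hinf⟩
  rintro rfl
  rw [Reduced, List.Chain'] at hred
  simp [Ypow] at hred

theorem exists_isInfix_rotate {R : Word} (hcr : ∀ n, Reduced (R.rotate n)) {a : L}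
    (ha : a.isX = true) (hmem : a ∈ R) (hinv : a.inv ∈ R) :
    ∃ k : ℤ, k ≠ 0 ∧ ∃ n, (a :: (Ypow k ++ [a.inv])) <:+: R.rotate n := by
  obtain ⟨s, t, rfl⟩ := List.append_of_mem hmem
  have hrot : (s ++ a :: t).rotate s.length = a :: (t ++ s) := by simp
  have hne : a.inv ≠ a := by cases a <;> simp [L.inv]
  obtain ⟨k, hk, hinf⟩ := Reduced.exists_isInfix_Ypow (u := t ++ s) ha
    (hrot ▸ hcr s.length) (by simp_all [or_comm])
  exact ⟨k, hk, s.length, hrot ▸ hinf⟩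

/-- a cyclically reduced word `R` with `phi R = 1` and at least two
`X`-letters has, up to cyclic permutation, contiguous subwords `X Yᵏ X⁻¹` and
`X⁻¹ Yᵏ' X` for some nonzero integers `k, k'`. -/
theorem cyclically_reduced_has_elementary_subwords (R : Word)
    (hcr : ∀ n, Reduced (R.rotate n)) (hphi : phi R = 1) (hX : 2 ≤ numX R) :
    (∃ k : ℤ, k ≠ 0 ∧ ∃ n, (L.X :: (Ypow k ++ [L.Xi])) <:+: R.rotate n) ∧
    (∃ k : ℤ, k ≠ 0 ∧ ∃ n, (L.Xi :: (Ypow k ++ [L.X])) <:+: R.rotate n) := by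
  rw [phi_eq_count_sub_count] at hphi
  rw [numX_eq_count_add_count] at hX
  have hX_mem : L.X ∈ R := List.count_pos_iff.1 (by omega)
  have hXi_mem : L.Xi ∈ R := List.count_pos_iff.1 (by omega)
  exact ⟨exists_isInfix_rotate hcr (a := L.X) rfl hX_mem hXi_mem,
    exists_isInfix_rotate hcr (a := L.Xi) rfl hXi_mem hX_mem⟩
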